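/- Let Γ be a (3,10,41)-graph with at least 172 edges. Then every vertex of Γ has degree at most 9, and Γ has at least 16 vertices of degree exactly 9 (so the maximum degree of Γ is 9). -/

import Mathlib

/-- A (3,10,41)-graph with at least 172 edges has all degrees at most 9
and at least 16 vertices of degree exactly 9. -/
theorem stmt_0 (Γ : SimpleGraph (Fin 41)) [DecidableRel Γ.Adj]
    (h3 : Γ.CliqueFree 3) (h10 : Γᶜ.CliqueFree 10)
    (hE : 172 ≤ Γ.edgeFinset.card) :
    (∀ v : Fin 41, Γ.degree v ≤ 9) ∧
    16 ≤ (Finset.univ.filter fun v : Fin 41 => Γ.degree v = 9).card := by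
  have hd : ∀ v : Fin 41, Γ.degree v ≤ 9 := by
    intro v
    by_contra hv
    obtain ⟨s, hs, hc⟩ := Finset.exists_subset_card_eq
      (show 10 ≤ (Γ.neighborFinset v).card by
        rw [SimpleGraph.card_neighborFinset_eq_degree]; omega)
    refine h10 s ⟨?_, hc⟩
    intro a ha b hb hab
    have h1 := hs ha
    have h2 := hs hb
    rw [SimpleGraph.mem_neighborFinset] at h1 h2
    rw [SimpleGraph.compl_adj]
    exact ⟨hab, SimpleGraph.isIndepSet_neighborSet_of_triangleFree Γ h3 v h1 h2 hab⟩
  refine ⟨hd, ?_⟩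
  have hsum := Γ.sum_degrees_eq_twice_card_edges
  have hle : ∑ v, Γ.degree v ≤ ∑ v : Fin 41, (8 + if Γ.degree v = 9 then 1 else 0) := by
    apply Finset.sum_le_sum
    intro v _
    have := hd v
    split_ifs <;> omega
  rw [Finset.sum_add_distrib, ← Finset.card_filter] at hle
  simp only [Finset.sum_const, Finset.card_univ, Fintype.card_fin, smul_eq_mul] at hle
  omega
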